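/- arXiv:1210.6370 — 2 statements merged into one kernel-verified Lean document; each statement's English description precedes it below -/
import Mathlib

section
/- In the two-player sensing game, assume additionally l > a and α < (β* − γ*)/(1 − β*γ*). Set D = (1−α)a − l + a − (1−α)φ and y* = ((1−α)a − l)/D. Then D < 0, y* ∈ (0,1), and the mixed profile in which each player plays NS with probability y* (and S with probability 1−y*) is a mixed Nash equilibrium; in particular, against the opponent's mixture, each player's expected utility from NS equals his expected utility from S. -/
inductive SenseAction
  | S
  | NS
  deriving DecidableEq

open SenseAction

/-- assuming l > a and α < (β*−γ*)/(1−β*γ*), with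
D = (1−α)a − l + a − (1−α)φ and y* = ((1−α)a − l)/D, we have D < 0, y* ∈ (0,1), the
symmetric mixed profile where each player plays NS with probability y* is a mixed Nash
equilibrium, and each player is indifferent between NS and S against the opponent's mix. -/
theorem stmt6
    (β γ α R1 R2 g1 g2 σ2 b c : ℝ)
    (hβ0 : 0 < β) (hβ1 : β < 1) (hγ : 0 < γ) (hγβ : γ * β < 1)
    (hα0 : 0 < α) (hα1 : α < 1)
    (hR1 : 0 < R1) (hR2 : 0 < R2) (hg1 : 0 < g1) (hg2 : 0 < g2)
    (hσ : 0 < σ2) (hb : 0 < b) (hc : 0 < c)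
    (w1 w2 a l φ : ℝ)
    (hw1 : w1 = R1 * g1 / σ2) (hw2 : w2 = R2 * g2 / σ2)
    (ha : a = b * (1 - β) / β)
    (hl : l = c * (1 - γ * β) / (γ * (1 + β)))
    (hφ : φ = b * (1 - γ * β) / (β * (1 + γ)))
    (U1 U2 : SenseAction → SenseAction → ℝ)
    (hU1nn : U1 NS NS = w1 * a) (hU1ns : U1 NS S = w1 * l)
    (hU1sn : U1 S NS = w1 * ((1 - α) * φ)) (hU1ss : U1 S S = w1 * ((1 - α) * a))
    (hU2nn : U2 NS NS = w2 * a) (hU2ns : U2 NS S = w2 * ((1 - α) * φ))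
    (hU2sn : U2 S NS = w2 * l) (hU2ss : U2 S S = w2 * ((1 - α) * a))
    (hla : l > a)
    (isNE : SenseAction → SenseAction → Prop)
    (hNE : ∀ s1 s2, isNE s1 s2 ↔
      ((∀ t1, U1 t1 s2 ≤ U1 s1 s2) ∧ (∀ t2, U2 s1 t2 ≤ U2 s1 s2)))
    (EU1 EU2 : ℝ → ℝ → ℝ)
    (hEU1 : ∀ x y, EU1 x y = x * (y * U1 NS NS + (1 - y) * U1 NS S)
        + (1 - x) * (y * U1 S NS + (1 - y) * U1 S S))
    (hEU2 : ∀ x y, EU2 x y = y * (x * U2 NS NS + (1 - x) * U2 S NS)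
        + (1 - y) * (x * U2 NS S + (1 - x) * U2 S S))
    (mixedNE : ℝ → ℝ → Prop)
    (hmixedNE : ∀ x y, mixedNE x y ↔
      ((∀ x', 0 ≤ x' → x' ≤ 1 → EU1 x' y ≤ EU1 x y) ∧
       (∀ y', 0 ≤ y' → y' ≤ 1 → EU2 x y' ≤ EU2 x y)))
    (hα : α < (β - γ) / (1 - β * γ))
    (D ystar : ℝ)
    (hD : D = (1 - α) * a - l + a - (1 - α) * φ)
    (hy : ystar = ((1 - α) * a - l) / D) :
    D < 0 ∧ 0 < ystar ∧ ystar < 1 ∧ mixedNE ystar ystar ∧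
    (ystar * U1 NS NS + (1 - ystar) * U1 NS S
      = ystar * U1 S NS + (1 - ystar) * U1 S S) ∧
    (ystar * U2 NS NS + (1 - ystar) * U2 S NS
      = ystar * U2 NS S + (1 - ystar) * U2 S S) := by
  have hpos : 0 < 1 - β * γ := by nlinarith
  have hα' : α * (1 - β * γ) < β - γ := (lt_div_iff₀ hpos).1 hα
  have ha0 : 0 < a := by
    rw [ha]
    exact div_pos (mul_pos hb (by linarith)) hβ0
  have hkey : a < (1 - α) * φ := by
    have e : (1 - α) * φ - a
        = b * ((β - γ) - α * (1 - β * γ)) / (β * (1 + γ)) := by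
      rw [ha, hφ]
      have h1 : (1 + γ) ≠ 0 := by positivity
      field_simp
      ring
    have : 0 < b * ((β - γ) - α * (1 - β * γ)) / (β * (1 + γ)) :=
      div_pos (mul_pos hb (by linarith)) (by positivity)
    linarith
  have hN : (1 - α) * a - l < 0 := by nlinarith [mul_pos hα0 ha0]
  have hD0 : D < 0 := by linarith
  have hyD : ystar * D = (1 - α) * a - l := by
    rw [hy]
    exact div_mul_cancel₀ _ hD0.ne
  have i1 : ystar * U1 NS NS + (1 - ystar) * U1 NS S
      = ystar * U1 S NS + (1 - ystar) * U1 S S := by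
    rw [hU1nn, hU1ns, hU1sn, hU1ss]
    rw [hD] at hyD
    linear_combination w1 * hyD
  have i2 : ystar * U2 NS NS + (1 - ystar) * U2 S NS
      = ystar * U2 NS S + (1 - ystar) * U2 S S := by
    rw [hU2nn, hU2ns, hU2sn, hU2ss]
    rw [hD] at hyD
    linear_combination w2 * hyD
  refine ⟨hD0, ?_, ?_, ?_, i1, i2⟩
  · rw [hy]
    exact div_pos_of_neg_of_neg hN hD0
  · rw [hy, div_lt_one_of_neg hD0]
    linarith
  · rw [hmixedNE]
    refine ⟨fun x' _ _ => le_of_eq ?_, fun y' _ _ => le_of_eq ?_⟩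
    · rw [hEU1, hEU1, i1]
      ring
    · rw [hEU2, hEU2, i2]
      ring
end

section
/- Consider a two-player game in which each player chooses an action in a two-element set {S,NS}, with utilities U₁(s₁,s₂) = w₁·Ũ(s₁,s₂) and U₂(s₁,s₂) = w₂·Ũ(s₂,s₁) for some function Ũ : {S,NS}² → ℝ and positive weights w₁, w₂ > 0. Then the game admits an exact potential (a function V : {S,NS}² → ℝ with U_i(s_i,s_{−i}) − U_i(t_i,s_{−i}) = V(s_i,s_{−i}) − V(t_i,s_{−i}) for every player i and all actions) if and only if w₁ = w₂ or Ũ(S,NS) − Ũ(NS,NS) + Ũ(NS,S) − Ũ(S,S) = 0. -/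
open SenseAction

/-- a two-player two-action game with weighted symmetric structure
U₁(s₁,s₂) = w₁·Ũ(s₁,s₂), U₂(s₁,s₂) = w₂·Ũ(s₂,s₁) admits an exact potential iff
w₁ = w₂ or Ũ(S,NS) − Ũ(NS,NS) + Ũ(NS,S) − Ũ(S,S) = 0. -/
theorem stmt9 (Ut : SenseAction → SenseAction → ℝ) (w1 w2 : ℝ)
    (hw1 : 0 < w1) (hw2 : 0 < w2)
    (U1 U2 : SenseAction → SenseAction → ℝ)
    (hU1 : ∀ s1 s2, U1 s1 s2 = w1 * Ut s1 s2)
    (hU2 : ∀ s1 s2, U2 s1 s2 = w2 * Ut s2 s1) :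
    (∃ V : SenseAction → SenseAction → ℝ,
        (∀ s1 t1 s2, U1 s1 s2 - U1 t1 s2 = V s1 s2 - V t1 s2) ∧
        (∀ s1 s2 t2, U2 s1 s2 - U2 s1 t2 = V s1 s2 - V s1 t2)) ↔
      (w1 = w2 ∨ Ut S NS - Ut NS NS + Ut NS S - Ut S S = 0) := by
  constructor
  · rintro ⟨V, h1, h2⟩
    have a := h1 S NS S
    have b := h1 S NS NS
    have c := h2 S S NS
    have d := h2 NS S NS
    simp only [hU1, hU2] at a b c d
    have h : (w1 - w2) * (Ut S NS - Ut NS NS + Ut NS S - Ut S S) = 0 := by linarith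
    rcases mul_eq_zero.mp h with h | h
    · left; linarith
    · right; exact h
  · intro h
    have hk : (w1 - w2) * (Ut S NS - Ut NS NS + Ut NS S - Ut S S) = 0 := by
      rcases h with h | h
      · rw [h]; ring
      · rw [h]; ring
    refine ⟨fun s1 s2 => w1 * (Ut s1 s2 - Ut NS s2) + w2 * Ut s2 NS, ?_, ?_⟩
    · intro s1 t1 s2
      simp only [hU1]
      ring
    · intro s1 s2 t2
      simp only [hU2]
      cases s1 <;> cases s2 <;> cases t2 <;> linarith
end
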